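/- Let H be a 3-graph and let B > 0 and b > 1 be real numbers such that R(H, K_t) ≤ t^{B·t^b} for all integers t ≥ 1. Then for every ε ∈ (0, 1/b) there exists a constant C_ε > 0 such that for all integers r ≥ 2 one has m_H(r) ≥ C_ε·r^3·(ln r)^{1/b − ε}. -/

import Mathlib

/-- A 3-graph: a finite vertex set `Fin n` together with a family of 3-element edges. -/
structure ThreeGraph where
  n : ℕ
  edges : Finset (Finset (Fin n))
  card_eq : ∀ e ∈ edges, e.card = 3

namespace ThreeGraph

/-- `G` contains a (not necessarily induced) copy of `H`. -/
def ContainsCopy (G H : ThreeGraph) : Prop :=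
  ∃ f : Fin H.n ↪ Fin G.n, ∀ e ∈ H.edges, e.image f ∈ G.edges

/-- `G` is `H`-free: it contains no subgraph isomorphic to `H`. -/
def Free (G H : ThreeGraph) : Prop := ¬ G.ContainsCopy H

/-- `G` admits a proper coloring with `r` colors: no edge is monochromatic. -/
def Colorable (G : ThreeGraph) (r : ℕ) : Prop :=
  ∃ c : Fin G.n → Fin r, ∀ e ∈ G.edges, ∃ u ∈ e, ∃ v ∈ e, c u ≠ c v

/-- `S` is an independent set in `G`: it contains no edge of `G`. -/
def IndepSet (G : ThreeGraph) (S : Finset (Fin G.n)) : Prop :=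
  ∀ e ∈ G.edges, ¬ e ⊆ S

/-- The degree of a vertex: the number of edges containing it. -/
def degree (G : ThreeGraph) (v : Fin G.n) : ℕ :=
  (G.edges.filter (fun e => v ∈ e)).card

end ThreeGraph

/-- Every 3-graph on `N` vertices contains a copy of `H` or an independent set of `t` vertices. -/
def RamseyProp (H : ThreeGraph) (t N : ℕ) : Prop :=
  ∀ G : ThreeGraph, G.n = N →
    G.ContainsCopy H ∨ ∃ S : Finset (Fin G.n), G.IndepSet S ∧ t ≤ S.card

/-- The Ramsey number `R(H, K_t)`: the least `N` such that every 3-graph on `N` vertices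
contains a copy of `H` or an independent set of `t` vertices. -/
noncomputable def ramsey (H : ThreeGraph) (t : ℕ) : ℕ :=
  sInf {N | RamseyProp H t N}

open Finset in
/-- Ramsey's theorem for `k`-subsets and two colors. -/
theorem exists_ramsey_bound {α : Type*} [DecidableEq α] (k p q : ℕ) :
    ∃ N : ℕ, ∀ (C : Finset α → Prop) (V : Finset α), N ≤ #V →
      (∃ S ⊆ V, #S = p ∧ ∀ s ⊆ S, #s = k → C s) ∨
      (∃ S ⊆ V, #S = q ∧ ∀ s ⊆ S, #s = k → ¬ C s) := by
  induction k generalizing p q with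
  | zero =>
    refine ⟨max p q, fun C V hV => ?_⟩
    by_cases h : C ∅
    · obtain ⟨S, hS, hc⟩ := exists_subset_card_eq ((le_max_left p q).trans hV)
      refine Or.inl ⟨S, hS, hc, fun s _ h0 => ?_⟩
      rwa [card_eq_zero.1 h0]
    · obtain ⟨S, hS, hc⟩ := exists_subset_card_eq ((le_max_right p q).trans hV)
      refine Or.inr ⟨S, hS, hc, fun s _ h0 => ?_⟩
      rwa [card_eq_zero.1 h0]
  | succ k ihk =>
    have extend : ∀ (D : Finset α → Prop) (v : α) (T A : Finset α), v ∉ T → A ⊆ T →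
        (∀ s ⊆ T, #s = k → D (insert v s)) → (∀ s ⊆ A, #s = k + 1 → D s) →
        ∀ s ⊆ insert v A, #s = k + 1 → D s := by
      intro D v T A hv hAT hT hA s hs hc
      by_cases hvs : v ∈ s
      · rw [← insert_erase hvs]
        refine hT _ (fun x hx => ?_) (by rw [card_erase_of_mem hvs, hc]; rfl)
        rw [mem_erase] at hx
        exact hAT ((mem_insert.1 (hs hx.2)).resolve_left hx.1)
      · exact hA s (fun x hx => (mem_insert.1 (hs hx)).resolve_left
          fun h => hvs (h ▸ hx)) hc
    induction p generalizing q with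
    | zero =>
      refine ⟨0, fun C V _ => Or.inl ⟨∅, by simp, by simp, fun s hs hc => ?_⟩⟩
      rw [subset_empty.1 hs] at hc
      simp at hc
    | succ p ihp =>
      induction q with
      | zero =>
        refine ⟨0, fun C V _ => Or.inr ⟨∅, by simp, by simp, fun s hs hc => ?_⟩⟩
        rw [subset_empty.1 hs] at hc
        simp at hc
      | succ q ihq =>
        obtain ⟨P, hP⟩ := ihp (q + 1)
        obtain ⟨Q, hQ⟩ := ihq
        obtain ⟨N, hN⟩ := ihk P Q
        refine ⟨N + 1, fun C V hV => ?_⟩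
        obtain ⟨v, hv⟩ : V.Nonempty := card_pos.1 (by omega)
        have hV' : N ≤ #(V.erase v) := by rw [card_erase_of_mem hv]; omega
        rcases hN (fun s => C (insert v s)) (V.erase v) hV' with
          ⟨T, hTV, hTc, hT⟩ | ⟨T, hTV, hTc, hT⟩
        · have hvT : v ∉ T := fun h => notMem_erase v V (hTV h)
          have hTV' := hTV.trans (erase_subset v V)
          rcases hP C T hTc.ge with ⟨A, hAT, hAc, hA⟩ | ⟨A, hAT, hAc, hA⟩
          · refine Or.inl ⟨insert v A, insert_subset hv (hAT.trans hTV'), ?_,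
              extend C v T A hvT hAT hT hA⟩
            rw [card_insert_of_notMem (fun h => hvT (hAT h)), hAc]
          · exact Or.inr ⟨A, hAT.trans hTV', hAc, hA⟩
        · have hvT : v ∉ T := fun h => notMem_erase v V (hTV h)
          have hTV' := hTV.trans (erase_subset v V)
          rcases hQ C T hTc.ge with ⟨A, hAT, hAc, hA⟩ | ⟨A, hAT, hAc, hA⟩
          · exact Or.inl ⟨A, hAT.trans hTV', hAc, hA⟩
          · refine Or.inr ⟨insert v A, insert_subset hv (hAT.trans hTV'), ?_,
              extend (fun s => ¬ C s) v T A hvT hAT hT hA⟩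
            rw [card_insert_of_notMem (fun h => hvT (hAT h)), hAc]

/-- The Ramsey number `R(H, K_t)` is finite. -/
theorem exists_ramseyProp (H : ThreeGraph) (t : ℕ) : ∃ N, RamseyProp H t N := by
  obtain ⟨N, hN⟩ := exists_ramsey_bound (α := ℕ) 3 H.n t
  refine ⟨N, fun G hG => ?_⟩
  rcases hN (fun s => ∃ e ∈ G.edges, e.map Fin.valEmbedding = s)
    (Finset.univ.map (Fin.valEmbedding (n := G.n))) (by simp [hG]) with
    ⟨S, hSV, hSc, hS⟩ | ⟨S, hSV, hSc, hS⟩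
  all_goals
    obtain ⟨T, -, rfl⟩ := Finset.subset_map_iff.1 hSV
    rw [Finset.card_map] at hSc
  · refine Or.inl ⟨(T.orderEmbOfFin hSc).toEmbedding, fun e he => ?_⟩
    have hcard : (e.image (T.orderEmbOfFin hSc).toEmbedding).card = 3 := by
      rw [Finset.card_image_of_injective _ (Function.Embedding.injective _), H.card_eq e he]
    have hsub : e.image (T.orderEmbOfFin hSc).toEmbedding ⊆ T := by
      intro x hx
      obtain ⟨y, -, rfl⟩ := Finset.mem_image.1 hx
      exact T.orderEmbOfFin_mem hSc y
    obtain ⟨e', he', h⟩ := hS _ (Finset.map_subset_map.2 hsub) (by rw [Finset.card_map, hcard])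
    rwa [← Finset.map_injective _ h]
  · refine Or.inr ⟨T, fun e he heT => ?_, hSc.ge⟩
    exact hS (e.map Fin.valEmbedding) (Finset.map_subset_map.2 heT)
      (by rw [Finset.card_map, G.card_eq e he]) ⟨e, he, rfl⟩

namespace ThreeGraph

/-- The pullback of a 3-graph along an injection of vertex sets. -/
def comap (G : ThreeGraph) {m : ℕ} (f : Fin m ↪ Fin G.n) : ThreeGraph where
  n := m
  edges := Finset.univ.filter fun e => e.map f ∈ G.edges
  card_eq e he := by
    have := G.card_eq _ (Finset.mem_filter.1 he).2
    rwa [Finset.card_map] at this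

theorem mem_edges_comap {G : ThreeGraph} {m : ℕ} {f : Fin m ↪ Fin G.n}
    {e : Finset (Fin (G.comap f).n)} :
    e ∈ (G.comap f).edges ↔ Finset.map (α := Fin (G.comap f).n) f e ∈ G.edges :=
  Finset.mem_filter_univ (α := Finset (Fin m)) e

theorem Free.exists_indepSet_of_ramsey_le {G H : ThreeGraph} (hG : G.Free H) (t : ℕ)
    (U : Finset (Fin G.n)) (hU : ramsey H t ≤ U.card) :
    ∃ S ⊆ U, G.IndepSet S ∧ t ≤ S.card := by
  have hR : RamseyProp H t (ramsey H t) := Nat.sInf_mem (exists_ramseyProp H t)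
  obtain ⟨W, hWU, hWc⟩ := Finset.exists_subset_card_eq hU
  let f : Fin (ramsey H t) ↪ Fin G.n := (W.orderEmbOfFin hWc).toEmbedding
  rcases hR (G.comap f) rfl with ⟨g, hg⟩ | ⟨S, hS, hSc⟩
  · refine absurd ⟨g.trans f, fun e he => ?_⟩ hG
    change Fin H.n ↪ Fin (ramsey H t) at g
    have h : (e.image g).map f ∈ G.edges := mem_edges_comap.1 (hg e he)
    rw [Finset.map_eq_image, Finset.image_image] at h
    exact h
  · change Finset (Fin (ramsey H t)) at S
    refine ⟨S.map f, fun x hx => ?_, fun e he heS => ?_, by rwa [Finset.card_map]⟩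
    · obtain ⟨y, -, rfl⟩ := Finset.mem_map.1 hx
      exact hWU (W.orderEmbOfFin_mem hWc y)
    · obtain ⟨e', he', rfl⟩ := Finset.subset_map_iff.1 heS
      exact hS e' (mem_edges_comap.2 he) he'

/-- The subgraph induced on `S` has a proper coloring with `q` colors. -/
def ColorableOn (G : ThreeGraph) (S : Finset (Fin G.n)) (q : ℕ) : Prop :=
  ∃ c : Fin G.n → ℕ, (∀ v ∈ S, c v < q) ∧
    ∀ e ∈ G.edges, e ⊆ S → ∃ u ∈ e, ∃ v ∈ e, c u ≠ c v

theorem ColorableOn.mono {G : ThreeGraph} {S : Finset (Fin G.n)} {p q : ℕ}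
    (h : G.ColorableOn S p) (hpq : p ≤ q) : G.ColorableOn S q := by
  obtain ⟨c, hc, h⟩ := h
  exact ⟨c, fun v hv => (hc v hv).trans_le hpq, h⟩

theorem ColorableOn.union {G : ThreeGraph} {S T : Finset (Fin G.n)} {p q : ℕ}
    (hS : G.ColorableOn S p) (hT : G.ColorableOn T q) : G.ColorableOn (S ∪ T) (p + q) := by
  obtain ⟨c, hc, hce⟩ := hS
  obtain ⟨d, hd, hde⟩ := hT
  refine ⟨fun v => if v ∈ S then c v else p + d v, fun v hv => ?_, fun e he heST => ?_⟩
  · by_cases hvS : v ∈ S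
    · have := hc v hvS
      simp only [hvS, if_true]
      omega
    · have := hd v ((Finset.mem_union.1 hv).resolve_left hvS)
      simp only [hvS, if_false]
      omega
  · by_cases h1 : e ⊆ S
    · obtain ⟨u, hu, v, hv, h⟩ := hce e he h1
      exact ⟨u, hu, v, hv, by simpa [h1 hu, h1 hv] using h⟩
    · obtain ⟨u, hu, huS⟩ := Finset.not_subset.1 h1
      by_cases h2 : ∃ v ∈ e, v ∈ S
      · obtain ⟨v, hv, hvS⟩ := h2
        have := hc v hvS
        refine ⟨u, hu, v, hv, ?_⟩
        simp only [huS, hvS, if_false, if_true]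
        omega
      · push Not at h2
        obtain ⟨u, hu, v, hv, h⟩ := hde e he fun x hx =>
          (Finset.mem_union.1 (heST hx)).resolve_left (h2 x hx)
        exact ⟨u, hu, v, hv, by simpa [h2 u hu, h2 v hv] using h⟩

theorem ColorableOn.colorable {G : ThreeGraph} {q : ℕ} (h : G.ColorableOn Finset.univ q) :
    G.Colorable q := by
  obtain ⟨c, hc, h⟩ := h
  refine ⟨fun v => ⟨c v, hc v (Finset.mem_univ v)⟩, fun e he => ?_⟩
  obtain ⟨u, hu, v, hv, huv⟩ := h e he (Finset.subset_univ e)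
  exact ⟨u, hu, v, hv, fun h => huv (congrArg Fin.val h)⟩

theorem IndepSet.colorableOn {G : ThreeGraph} {S : Finset (Fin G.n)} (h : G.IndepSet S) :
    G.ColorableOn S 1 :=
  ⟨fun _ => 0, fun _ _ => one_pos, fun e he heS => absurd heS (h e he)⟩

theorem colorableOn_card (G : ThreeGraph) (S : Finset (Fin G.n)) : G.ColorableOn S S.card := by
  refine ⟨fun v => if h : v ∈ S then S.equivFin ⟨v, h⟩ else 0, fun v hv => ?_,
    fun e he heS => ?_⟩
  · simp [hv]
  · obtain ⟨u, hu, v, hv, huv⟩ := Finset.one_lt_card.1 (by rw [G.card_eq e he]; omega)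
    refine ⟨u, hu, v, hv, ?_⟩
    simp only [heS hu, heS hv, dif_pos]
    intro h
    have := S.equivFin.injective (Fin.ext h)
    exact huv (congrArg Subtype.val this)

/-- Greedily removing independent sets of size `t` until fewer than `R` vertices are left. -/
theorem colorableOn_of_indepSet (G : ThreeGraph) (t R : ℕ)
    (h : ∀ U : Finset (Fin G.n), R ≤ U.card → ∃ S ⊆ U, G.IndepSet S ∧ t ≤ S.card)
    (q : ℕ) (U : Finset (Fin G.n)) (hU : U.card ≤ q * t) : G.ColorableOn U (q + R) := by
  induction q generalizing U with
  | zero => exact (G.colorableOn_card U).mono (by omega)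
  | succ q ih =>
    rcases lt_or_ge U.card R with hlt | hge
    · exact (G.colorableOn_card U).mono (by omega)
    · obtain ⟨S, hSU, hS, hSt⟩ := h U hge
      have := (ih (U \ S) (by rw [Finset.card_sdiff_of_subset hSU]; rw [add_mul] at hU; omega)).union
        hS.colorableOn
      rw [Finset.sdiff_union_of_subset hSU] at this
      exact this.mono (by omega)

open Finset in
/-- The first moment bound: at most a `1 / k ^ 2` fraction of all colorings with `k` colors
make a given triple monochromatic. -/
theorem card_mono_mul_le {n k : ℕ} (e : Finset (Fin n)) (he : #e = 3) :
    #{c : Fin n → Fin k | ∀ u ∈ e, ∀ v ∈ e, c u = c v} * k ^ 2 ≤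
      Fintype.card (Fin n → Fin k) := by
  obtain ⟨u, v, w, huv, huw, hvw, rfl⟩ := card_eq_three.1 he
  set M : Finset (Fin n → Fin k) :=
    {c : Fin n → Fin k | ∀ x ∈ ({u, v, w} : Finset (Fin n)), ∀ y ∈ ({u, v, w} : Finset (Fin n)),
      c x = c y}
  have hcard : #M * k ^ 2 = #(M ×ˢ (univ : Finset (Fin k × Fin k))) := by
    simp [card_product, sq]
  rw [hcard, ← card_univ]
  refine card_le_card_of_injOn
    (fun p => Function.update (Function.update p.1 u p.2.1) v p.2.2) (by simp) ?_
  rintro ⟨c, i, j⟩ hc ⟨d, i', j'⟩ hd h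
  have hc' : c u = c w ∧ c v = c w := by
    have := (mem_filter.1 (mem_product.1 hc).1).2
    exact ⟨this u (by simp) w (by simp), this v (by simp) w (by simp)⟩
  have hd' : d u = d w ∧ d v = d w := by
    have := (mem_filter.1 (mem_product.1 hd).1).2
    exact ⟨this u (by simp) w (by simp), this v (by simp) w (by simp)⟩
  have key : ∀ x, Function.update (Function.update c u i) v j x =
      Function.update (Function.update d u i') v j' x := fun x => congrFun h x
  have hw : c w = d w := by simpa [huw.symm, hvw.symm] using key w
  have hi : i = i' := by simpa [huv] using key u
  have hj : j = j' := by simpa using key v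
  have hcd : c = d := by
    funext x
    by_cases hxu : x = u
    · rw [hxu, hc'.1, hd'.1, hw]
    by_cases hxv : x = v
    · rw [hxv, hc'.2, hd'.2, hw]
    simpa [hxu, hxv] using key x
  rw [hcd, hi, hj]

open Finset in
theorem exists_coloring_few_mono (G : ThreeGraph) {k : ℕ} (hk : 0 < k) :
    ∃ c : Fin G.n → Fin k,
      #{e ∈ G.edges | ∀ u ∈ e, ∀ v ∈ e, c u = c v} * k ^ 2 ≤ #G.edges := by
  have : Nonempty (Fin k) := ⟨⟨0, hk⟩⟩
  by_contra! h
  have h1 := sum_lt_sum_of_nonempty (univ_nonempty (α := Fin G.n → Fin k)) fun c _ => h c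
  have h2 : ∑ c : Fin G.n → Fin k, #{e ∈ G.edges | ∀ u ∈ e, ∀ v ∈ e, c u = c v} * k ^ 2 =
      ∑ e ∈ G.edges, #{c : Fin G.n → Fin k | ∀ u ∈ e, ∀ v ∈ e, c u = c v} * k ^ 2 := by
    rw [← sum_mul, ← sum_mul]
    congr 1
    simp only [card_filter]
    exact sum_comm
  have h3 := sum_le_sum fun e he => card_mono_mul_le (k := k) e (G.card_eq e he)
  rw [← h2] at h3
  rw [sum_const, smul_eq_mul] at h1 h3
  rw [card_univ, mul_comm] at h1
  omega

open Finset in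
/-- With `k` colors one can properly color all but at most `|E| / k ^ 2` vertices. -/
theorem exists_colorableOn_compl (G : ThreeGraph) {k : ℕ} (hk : 0 < k) :
    ∃ U : Finset (Fin G.n), #U * k ^ 2 ≤ #G.edges ∧ G.ColorableOn Uᶜ k := by
  obtain ⟨c, hc⟩ := G.exists_coloring_few_mono hk
  have hne : ∀ e : {e // e ∈ G.edges}, e.1.Nonempty := fun e =>
    card_pos.1 (by rw [G.card_eq e.1 e.2]; omega)
  choose pick hpick using hne
  classical
  let M := G.edges.attach.filter fun e => ∀ u ∈ e.1, ∀ v ∈ e.1, c u = c v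
  have hM : #M ≤ #{e ∈ G.edges | ∀ u ∈ e, ∀ v ∈ e, c u = c v} :=
    card_le_card_of_injOn Subtype.val
      (fun e he => by simpa [M] using And.intro e.2 (mem_filter.1 he).2)
      Subtype.val_injective.injOn
  refine ⟨M.image pick,
    (Nat.mul_le_mul_right _ (card_image_le.trans hM)).trans hc, fun v => c v, fun v _ => (c v).2,
    fun e he heU => ?_⟩
  by_contra! hmono
  have h := heU (hpick ⟨e, he⟩)
  rw [mem_compl] at h
  exact h (mem_image_of_mem pick (mem_filter.2
    ⟨mem_attach _ _, fun u hu v hv => Fin.ext (hmono u hu v hv)⟩))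

theorem Free.colorable {G H : ThreeGraph} (hG : G.Free H) {k t : ℕ} (hk : 0 < k)
    (hR : ramsey H t ≤ k) (hm : G.edges.card ≤ k ^ 3 * t) {r : ℕ} (hr : 3 * k ≤ r) :
    G.Colorable r := by
  obtain ⟨U, hU, hcol⟩ := G.exists_colorableOn_compl hk
  have hUt : U.card ≤ k * t := by
    refine Nat.le_of_mul_le_mul_right (c := k ^ 2) ?_ (by positivity)
    calc U.card * k ^ 2 ≤ k ^ 3 * t := hU.trans hm
      _ = k * t * k ^ 2 := by ring
  have h := hcol.union (G.colorableOn_of_indepSet t _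
    (hG.exists_indepSet_of_ramsey_le t) k U hUt)
  rw [Finset.union_comm, Finset.union_compl] at h
  exact (h.mono (by omega)).colorable

theorem edges_nonempty_of_not_colorable {G : ThreeGraph} {r : ℕ} (hr : 0 < r)
    (h : ¬ G.Colorable r) : G.edges.Nonempty := by
  by_contra h0
  rw [Finset.not_nonempty_iff_eq_empty] at h0
  exact h ⟨fun _ => ⟨0, hr⟩, by simp [h0]⟩

end ThreeGraph

open Filter in
theorem eventually_rpow_floor_le (B b ε : ℝ) (hB : 0 < B) (hb : 1 < b) (hε : 0 < ε)
    (hεb : ε < 1 / b) :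
    ∀ᶠ r : ℕ in atTop, 1 ≤ ⌊Real.log r ^ (1 / b - ε)⌋₊ ∧
      (⌊Real.log r ^ (1 / b - ε)⌋₊ : ℝ) ^ (B * (⌊Real.log r ^ (1 / b - ε)⌋₊ : ℝ) ^ b) ≤
        (r : ℝ) / 3 := by
  have hb0 : 0 < b := by linarith
  have ha : 0 < 1 / b - ε := by linarith
  have hlog : Tendsto (fun r : ℕ => Real.log r) atTop atTop :=
    Real.tendsto_log_atTop.comp tendsto_natCast_atTop_atTop
  have hlit := (isLittleO_log_rpow_atTop (mul_pos hε hb0)).bound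
    (show 0 < 1 / (2 * (1 / b - ε) * B) by positivity)
  filter_upwards [hlog.eventually hlit, hlog.eventually_ge_atTop 4, eventually_ge_atTop 3]
    with r h1 h2 h3
  set a := 1 / b - ε with ha_def
  set x := Real.log r with hx
  set t := ⌊x ^ a⌋₊ with ht
  have hx0 : 0 < x := by linarith
  have ht1 : 1 ≤ t := Nat.le_floor (by simpa using Real.one_le_rpow (by linarith) ha.le)
  have htR : (1 : ℝ) ≤ t := by exact_mod_cast ht1
  have htx : (t : ℝ) ≤ x ^ a := Nat.floor_le (by positivity)
  refine ⟨ht1, ?_⟩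
  have hr0 : (0 : ℝ) < r := by positivity
  have hlogx : 0 ≤ Real.log x := Real.log_nonneg (by linarith)
  rw [Real.norm_of_nonneg hlogx, Real.norm_of_nonneg (by positivity)] at h1
  have hlt : Real.log t ≤ a * Real.log x := by
    rw [← Real.log_rpow hx0]
    exact Real.log_le_log (by linarith) htx
  have htb : (t : ℝ) ^ b ≤ x ^ (1 - ε * b) := by
    calc (t : ℝ) ^ b ≤ (x ^ a) ^ b := Real.rpow_le_rpow (by positivity) htx hb0.le
      _ = x ^ (1 - ε * b) := by
        rw [← Real.rpow_mul hx0.le]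
        congr 1
        rw [ha_def]
        field_simp
  have hmain : Real.log t * (B * (t : ℝ) ^ b) ≤ x / 2 := by
    calc Real.log t * (B * (t : ℝ) ^ b)
        ≤ (a * (1 / (2 * a * B) * x ^ (ε * b))) * (B * x ^ (1 - ε * b)) := by
          gcongr
          exact hlt.trans (by gcongr)
      _ = (x ^ (ε * b) * x ^ (1 - ε * b)) / 2 := by field_simp
      _ = x / 2 := by
        rw [← Real.rpow_add hx0]
        simp
  have hlog3 : Real.log 3 ≤ 2 := by
    have := Real.log_le_sub_one_of_pos (show (0 : ℝ) < 3 by norm_num)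
    linarith
  rw [Real.rpow_def_of_pos (by linarith),
    ← Real.exp_log (show (0 : ℝ) < r / 3 by positivity)]
  rw [Real.exp_le_exp, Real.log_div hr0.ne' (by norm_num), ← hx]
  linarith

/-- If `R(H, K_t) ≤ t^(B·t^b)` for all `t ≥ 1` (with `B > 0`, `b > 1`), then
for every `ε ∈ (0, 1/b)` there is a constant `C_ε > 0` with
`m_H(r) ≥ C_ε·r^3·(ln r)^(1/b − ε)` for all `r ≥ 2`. -/
theorem mH_lower_of_ramsey_exp_upper
    (H : ThreeGraph) (B b : ℝ) (hB : 0 < B) (hb : 1 < b)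
    (hR : ∀ t : ℕ, 1 ≤ t → (ramsey H t : ℝ) ≤ (t : ℝ) ^ (B * (t : ℝ) ^ b)) :
    ∀ ε : ℝ, 0 < ε → ε < 1 / b → ∃ C : ℝ, 0 < C ∧
      ∀ r : ℕ, 2 ≤ r → ∀ G : ThreeGraph, G.Free H → ¬ G.Colorable r →
        C * (r : ℝ) ^ 3 * Real.log r ^ ((1 : ℝ) / b - ε) ≤ (G.edges.card : ℝ) := by
  intro ε hε hεb
  have ha : 0 < 1 / b - ε := by linarith
  obtain ⟨r₀, hr₀⟩ := Filter.eventually_atTop.1 (eventually_rpow_floor_le B b ε hB hb hε hεb)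
  set a := 1 / b - ε
  set r₁ := max r₀ 3
  have hr₁ : (3 : ℝ) ≤ r₁ := by exact_mod_cast le_max_right r₀ 3
  have hlog₁ : 0 < Real.log r₁ := Real.log_pos (by linarith)
  refine ⟨min (1 / 432) (1 / ((r₁ : ℝ) ^ 3 * Real.log r₁ ^ a)), by positivity, ?_⟩
  intro r hr G hG hcol
  have hr2 : (2 : ℝ) ≤ r := by exact_mod_cast hr
  have hlog : 0 < Real.log r := Real.log_pos (by linarith)
  rcases le_total r r₁ with hle | hge
  · have hle' : (r : ℝ) ≤ r₁ := by exact_mod_cast hle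
    have h1 : (1 : ℝ) ≤ G.edges.card := by
      exact_mod_cast (ThreeGraph.edges_nonempty_of_not_colorable (by omega) hcol).card_pos
    refine le_trans ?_ h1
    calc _ ≤ 1 / ((r₁ : ℝ) ^ 3 * Real.log r₁ ^ a) * (r₁ : ℝ) ^ 3 * Real.log r₁ ^ a := by
          gcongr
          exact min_le_right _ _
      _ = 1 := by field_simp
  · obtain ⟨ht1, htr⟩ := hr₀ r ((le_max_left r₀ 3).trans hge)
    have hr3 : 3 ≤ r := (le_max_right r₀ 3).trans hge
    set t := ⌊Real.log r ^ a⌋₊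
    have hR3 : (ramsey H t : ℝ) ≤ r / 3 := (hR t ht1).trans htr
    have hRk : ramsey H t ≤ r / 3 := by
      rw [Nat.le_div_iff_mul_le (by norm_num)]
      have : (ramsey H t : ℝ) * 3 ≤ r := by linarith
      exact_mod_cast this
    have hm : (r / 3) ^ 3 * t < G.edges.card := by
      by_contra! hm
      exact hcol (hG.colorable (by omega) hRk hm (by omega))
    have hk : (r : ℝ) / 6 ≤ (r / 3 : ℕ) := by
      have : r ≤ 6 * (r / 3) := by omega
      have : (r : ℝ) ≤ 6 * (r / 3 : ℕ) := by exact_mod_cast this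
      linarith
    have ht : Real.log r ^ a / 2 ≤ t := by
      have h1 : (1 : ℝ) ≤ t := by exact_mod_cast ht1
      have h2 := Nat.lt_floor_add_one (Real.log r ^ a)
      change _ < (t : ℝ) + 1 at h2
      linarith
    calc _ ≤ 1 / 432 * (r : ℝ) ^ 3 * Real.log r ^ a := by
          gcongr
          exact min_le_left _ _
      _ = ((r : ℝ) / 6) ^ 3 * (Real.log r ^ a / 2) := by ring
      _ ≤ ((r / 3 : ℕ) : ℝ) ^ 3 * t := by gcongr
      _ ≤ G.edges.card := by exact_mod_cast hm.le
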